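/- arXiv:2412.16993 — 2 statements merged into one kernel-verified Lean document; each statement's English description precedes it below -/
import Mathlib

section
/- Let d > 3 and let c be the positive real d-th root of 2. If a line L of ℙ²(ℂ) contains at least three distinct sextactic points of the Fermat curve F_d, then L is one of the 9d lines of B ∪ M ∪ N; that is, L is defined by an equation of the form x = αy, y = αz, or z = αx with α^d = 1, or of the form z = βy, x = βz, y = βx, y = βz, z = βx, or x = βy with β^d = −2. -/
/-- `v ∈ ℂ³` is (a vector of homogeneous coordinates of) a sextactic point of the Fermat
curve `F_d`: such points are `(a : 1 : b)`, `(1 : b : a)`, `(b : a : 1)` with `a^d = 1`,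
`b^d = -2`. -/
def IsSextacticVec (d : ℕ) (v : Fin 3 → ℂ) : Prop :=
  ∃ a b : ℂ, a ^ d = 1 ∧ b ^ d = -2 ∧
    (v = ![a, 1, b] ∨ v = ![1, b, a] ∨ v = ![b, a, 1])

lemma det_eq_zero {p q r x₁ y₁ z₁ x₂ y₂ z₂ x₃ y₃ z₃ : ℂ} (hl : p ≠ 0 ∨ q ≠ 0 ∨ r ≠ 0)
    (h₁ : p * x₁ + q * y₁ + r * z₁ = 0) (h₂ : p * x₂ + q * y₂ + r * z₂ = 0)
    (h₃ : p * x₃ + q * y₃ + r * z₃ = 0) :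
    x₁ * (y₂ * z₃ - z₂ * y₃) - y₁ * (x₂ * z₃ - z₂ * x₃) + z₁ * (x₂ * y₃ - y₂ * x₃) = 0 := by
  rcases hl with h | h | h <;> refine (mul_eq_zero.mp ?_).resolve_left h
  · linear_combination (y₂ * z₃ - z₂ * y₃) * h₁ - (y₁ * z₃ - z₁ * y₃) * h₂ +
      (y₁ * z₂ - z₁ * y₂) * h₃
  · linear_combination -(x₂ * z₃ - z₂ * x₃) * h₁ + (x₁ * z₃ - z₁ * x₃) * h₂ -
      (x₁ * z₂ - z₁ * x₂) * h₃
  · linear_combination (x₂ * y₃ - y₂ * x₃) * h₁ - (x₁ * y₃ - y₁ * x₃) * h₂ +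
      (x₁ * y₂ - y₁ * x₂) * h₃

/-- A line that contains three points `(a : 1 : b)` with `|a| = 1` and `|b|` constant
passes through a coordinate vertex. -/
lemma coeff_eq_zero_of_three_points {p q r a₁ b₁ a₂ b₂ a₃ b₃ : ℂ} {s : ℝ}
    (ha₁ : ‖a₁‖ = 1) (ha₂ : ‖a₂‖ = 1) (ha₃ : ‖a₃‖ = 1)
    (hb₁ : ‖b₁‖ = s) (hb₂ : ‖b₂‖ = s) (hb₃ : ‖b₃‖ = s)
    (h12 : ¬(a₁ = a₂ ∧ b₁ = b₂)) (h13 : ¬(a₁ = a₃ ∧ b₁ = b₃)) (h23 : ¬(a₂ = a₃ ∧ b₂ = b₃))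
    (h₁ : p * a₁ + q + r * b₁ = 0) (h₂ : p * a₂ + q + r * b₂ = 0)
    (h₃ : p * a₃ + q + r * b₃ = 0) : p = 0 ∨ q = 0 ∨ r = 0 := by
  by_contra! ⟨hp, hq, hr⟩
  have key : ∀ a b : ℂ, ‖a‖ = 1 → ‖b‖ = s → p * a + q + r * b = 0 →
      p * star q * a ^ 2 + (p * star p + q * star q - r * star r * (s : ℂ) ^ 2) * a
        + q * star p = 0 := by
    intro a b ha hb h
    have h' := congrArg star h
    simp only [star_add, star_mul, star_zero] at h'
    have e₁ : a * star a = 1 := by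
      have := Complex.mul_conj' a
      rw [ha] at this; simpa using this
    have e₂ : b * star b = (s : ℂ) ^ 2 := by
      have := Complex.mul_conj' b
      rw [hb] at this; simpa using this
    linear_combination (a * (star p * star a + star q)) * h - a * r * b * h' +
      a * r * star r * e₂ - (p * a * star p + q * star p) * e₁
  have k₁ := key a₁ b₁ ha₁ hb₁ h₁
  have k₂ := key a₂ b₂ ha₂ hb₂ h₂
  have k₃ := key a₃ b₃ ha₃ hb₃ h₃
  have inj : ∀ {a b a' b' : ℂ}, ¬(a = a' ∧ b = b') → p * a + q + r * b = 0 →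
      p * a' + q + r * b' = 0 → a - a' ≠ 0 := by
    intro a b a' b' hne h h' e
    refine hne ⟨sub_eq_zero.mp e, mul_left_cancel₀ hr ?_⟩
    linear_combination h - h' - p * e
  have n12 := inj h12 h₁ h₂
  have n13 := inj h13 h₁ h₃
  have n23 := inj h23 h₂ h₃
  have hz : p * star q * ((a₁ - a₂) * (a₁ - a₃) * (a₂ - a₃)) = 0 := by
    linear_combination (a₂ - a₃) * k₁ - (a₁ - a₃) * k₂ + (a₁ - a₂) * k₃
  exact mul_ne_zero (mul_ne_zero hp (star_ne_zero.mpr hq))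
    (mul_ne_zero (mul_ne_zero n12 n13) n23) hz

lemma norm_eq_one_of_pow {d : ℕ} (hd : d ≠ 0) {a : ℂ} (ha : a ^ d = 1) : ‖a‖ = 1 :=
  Complex.norm_eq_one_of_pow_eq_one ha hd

lemma norm_eq_of_pow {d : ℕ} (hd : d ≠ 0) {c : ℝ} (hc : 0 < c) (hcd : c ^ d = 2) {b : ℂ}
    (hb : b ^ d = -2) : ‖b‖ = c := by
  have h := congrArg norm hb
  rw [norm_pow, norm_neg, Complex.norm_ofNat, ← hcd] at h
  exact (pow_left_inj₀ (norm_nonneg b) hc.le hd).mp h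

/-- A line through three sextactic points `(a : 1 : b)` has one of three special forms. -/
lemma line_form_of_same_type {d : ℕ} (hd : d ≠ 0) {c : ℝ} (hc : 0 < c) (hcd : c ^ d = 2)
    {p q r a₁ b₁ a₂ b₂ a₃ b₃ : ℂ} (hl : p ≠ 0 ∨ q ≠ 0 ∨ r ≠ 0)
    (ha₁ : a₁ ^ d = 1) (ha₂ : a₂ ^ d = 1) (ha₃ : a₃ ^ d = 1)
    (hb₁ : b₁ ^ d = -2) (hb₂ : b₂ ^ d = -2) (hb₃ : b₃ ^ d = -2)
    (h12 : ¬(a₁ = a₂ ∧ b₁ = b₂)) (h13 : ¬(a₁ = a₃ ∧ b₁ = b₃)) (h23 : ¬(a₂ = a₃ ∧ b₂ = b₃))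
    (h₁ : p * a₁ + q + r * b₁ = 0) (h₂ : p * a₂ + q + r * b₂ = 0)
    (h₃ : p * a₃ + q + r * b₃ = 0) :
    ∃ t : ℂ, t ≠ 0 ∧ ((∃ α : ℂ, α ^ d = 1 ∧ p = t ∧ q = t * -α ∧ r = 0) ∨
      ∃ β : ℂ, β ^ d = -2 ∧
        ((p = 0 ∧ q = t * -β ∧ r = t) ∨ (p = t * -β ∧ q = 0 ∧ r = t))) := by
  have na₁ : a₁ ≠ 0 := by rintro rfl; simp [hd] at ha₁
  have nb₁ : b₁ ≠ 0 := by rintro rfl; simp [hd] at hb₁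
  rcases coeff_eq_zero_of_three_points (norm_eq_one_of_pow hd ha₁) (norm_eq_one_of_pow hd ha₂)
    (norm_eq_one_of_pow hd ha₃) (norm_eq_of_pow hd hc hcd hb₁) (norm_eq_of_pow hd hc hcd hb₂)
    (norm_eq_of_pow hd hc hcd hb₃) h12 h13 h23 h₁ h₂ h₃ with rfl | rfl | rfl
  · refine ⟨r, ?_, Or.inr ⟨b₁, hb₁, Or.inl ⟨rfl, by linear_combination h₁, rfl⟩⟩⟩
    rintro rfl
    simp_all
  · refine ⟨r, ?_, Or.inr ⟨b₁ / a₁, by rw [div_pow, ha₁, hb₁, div_one],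
      Or.inr ⟨?_, rfl, rfl⟩⟩⟩
    · rintro rfl
      simp_all
    · field_simp
      linear_combination h₁
  · refine ⟨p, ?_, Or.inl ⟨a₁, ha₁, rfl, by linear_combination h₁, rfl⟩⟩
    rintro rfl
    simp_all

open IntermediateField Polynomial in
/-- The field generated by the `2d`-th roots of unity contains `c ^ j`, where `c` is the
positive `d`-th root of `2`, only if `d ∣ 2 * j`. -/
lemma exists_cyclotomic_field {d : ℕ} (hd : d ≠ 0) {c : ℝ} (hc : 0 < c) (hcd : c ^ d = 2) :
    ∃ K : IntermediateField ℚ ℂ, (∀ x : ℂ, x ^ (2 * d) = 1 → x ∈ K) ∧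
      ∀ j : ℕ, (c : ℂ) ^ j ∈ K → d ∣ 2 * j := by
  have hn : 2 * d ≠ 0 := by omega
  have : NeZero (2 * d) := ⟨hn⟩
  have hζ := Complex.isPrimitiveRoot_exp (2 * d) hn
  set ζ := Complex.exp (2 * Real.pi * Complex.I / (2 * d : ℕ))
  have : IsCyclotomicExtension {2 * d} ℚ ℚ⟮ζ⟯ := by
    change IsCyclotomicExtension {2 * d} ℚ ℚ⟮ζ⟯.toSubalgebra
    rw [adjoin_simple_toSubalgebra_of_isAlgebraic
      (hζ.isIntegral (Nat.pos_of_ne_zero hn)).tower_top.isAlgebraic]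
    exact hζ.adjoin_isCyclotomicExtension ℚ
  have : IsGalois ℚ ℚ⟮ζ⟯ := IsCyclotomicExtension.isGalois {2 * d} ℚ ℚ⟮ζ⟯
  have : FiniteDimensional ℚ ℚ⟮ζ⟯ := IsCyclotomicExtension.finite_of_singleton (2 * d) ℚ ℚ⟮ζ⟯
  have hcomm := IsCyclotomicExtension.isMulCommutative {2 * d} ℚ ℚ⟮ζ⟯
  refine ⟨ℚ⟮ζ⟯, fun x hx => ?_, fun j hj => ?_⟩
  · obtain ⟨i, -, rfl⟩ := hζ.eq_pow_of_pow_eq_one hx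
    exact pow_mem (mem_adjoin_simple_self ℚ ζ) i
  set τ : Gal(ℚ⟮ζ⟯/ℚ) :=
    AlgEquiv.restrictNormal (Complex.conjAe.restrictScalars ℚ) ℚ⟮ζ⟯
  have hτ : ∀ x : ℚ⟮ζ⟯, ((τ x : ℚ⟮ζ⟯) : ℂ) = (starRingEnd ℂ) x := fun x =>
    AlgEquiv.restrictNormal_commutes (Complex.conjAe.restrictScalars ℚ) ℚ⟮ζ⟯ x
  set α : ℚ⟮ζ⟯ := ⟨(c : ℂ) ^ j, hj⟩ with hα
  have hτα : τ α = α := by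
    apply Subtype.ext
    rw [hτ]
    simp [hα]
  have hαd : α ^ d = 2 ^ j := by
    apply Subtype.ext
    change ((c : ℂ) ^ j) ^ d = 2 ^ j
    rw [← pow_mul, mul_comm, pow_mul]
    exact_mod_cast congrArg (fun x : ℝ => ((x ^ j : ℝ) : ℂ)) hcd
  have hfix : ∀ σ : Gal(ℚ⟮ζ⟯/ℚ), σ (α ^ 2) = α ^ 2 := by
    intro σ
    have h₁ : τ (σ α) = σ α := by
      have : τ * σ = σ * τ := hcomm.is_comm.comm τ σ
      have := congrArg (fun f : Gal(ℚ⟮ζ⟯/ℚ) => f α) this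
      simpa [hτα] using this
    have h₂ : (starRingEnd ℂ) (σ α : ℂ) = (σ α : ℂ) := by rw [← hτ, h₁]
    obtain ⟨y, hy⟩ := Complex.conj_eq_iff_real.mp h₂
    have h₃ : (σ α) ^ d = 2 ^ j := by rw [← map_pow, hαd, map_pow, map_ofNat]
    have h₄ : y ^ d = (c ^ j) ^ d := by
      have := congrArg (fun x : ℚ⟮ζ⟯ => (x : ℂ)) (h₃.trans hαd.symm)
      change (σ α : ℂ) ^ d = ((c : ℂ) ^ j) ^ d at this
      rw [hy] at this
      exact_mod_cast this
    have h₅ : |y| = c ^ j := by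
      have := congrArg abs h₄
      rw [abs_pow, abs_of_pos (pow_pos (pow_pos hc j) d)] at this
      exact (pow_left_inj₀ (abs_nonneg y) (pow_pos hc j).le hd).mp this
    have h₆ : y ^ 2 = (c ^ j) ^ 2 := by rw [← sq_abs, h₅]
    apply Subtype.ext
    rw [map_pow]
    change (σ α : ℂ) ^ 2 = ((c : ℂ) ^ j) ^ 2
    rw [hy]
    exact_mod_cast h₆
  obtain ⟨u, hu⟩ := (IsGalois.mem_range_algebraMap_iff_fixed (F := ℚ) (α ^ 2)).mpr hfix
  have hud : u ^ d = 2 ^ (2 * j) := by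
    apply (algebraMap ℚ ℚ⟮ζ⟯).injective
    rw [map_pow, hu, ← pow_mul, mul_comm, pow_mul, hαd]
    simp [← pow_mul, mul_comm]
  have hu0 : u ≠ 0 := by
    rintro rfl
    rw [zero_pow hd] at hud
    exact pow_ne_zero _ two_ne_zero hud.symm
  have : Fact (Nat.Prime 2) := ⟨Nat.prime_two⟩
  have hv := congrArg (padicValRat 2) hud
  rw [padicValRat.pow, padicValRat.pow] at hv
  have h2 : padicValRat 2 (2 : ℚ) = 1 := by exact_mod_cast padicValRat.self (p := 2) (by norm_num)
  rw [h2, mul_one] at hv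
  exact_mod_cast Dvd.intro _ hv

open Polynomial in
/-- The degree `m` of `c` over a field containing the `d`-th roots of unity satisfies
`c ^ m ∈ K`, for `c` a `d`-th root of `2`. -/
lemma exists_pow_mem_of_polynomial {d : ℕ} (hd : d ≠ 0) {c : ℂ} (hcd : c ^ d = 2)
    {K : IntermediateField ℚ ℂ} (hK : ∀ x : ℂ, x ^ (2 * d) = 1 → x ∈ K) {p : K[X]}
    (hp : p ≠ 0) (hpc : aeval c p = 0) : ∃ m, 0 < m ∧ m ≤ p.natDegree ∧ c ^ m ∈ K := by
  have hc0 : c ≠ 0 := by rintro rfl; simp [hd] at hcd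
  have h2 : ((2 : K) : ℂ) = 2 := rfl
  have hint : IsIntegral K c := by
    refine ⟨X ^ d - C 2, monic_X_pow_sub_C _ hd, ?_⟩
    simp [hcd, h2]
  have hdvd : minpoly K c ∣ X ^ d - C 2 := minpoly.dvd K c (by simp [hcd, h2])
  refine ⟨(minpoly K c).natDegree, minpoly.natDegree_pos hint,
    natDegree_le_of_dvd (minpoly.dvd K c hpc) hp, ?_⟩
  set f := (minpoly K c).map (algebraMap K ℂ)
  have hf : f.Monic := (minpoly.monic hint).map _
  have hs : f.Splits := IsAlgClosed.splits f
  have hprod : ∀ s : Multiset ℂ, (∀ r ∈ s, r ^ d = 2) → s.prod / c ^ s.card ∈ K := by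
    intro s
    induction s using Multiset.induction_on with
    | empty => intro _; simp
    | cons r s ih =>
      intro hr
      have h₁ := ih fun x hx => hr x (Multiset.mem_cons_of_mem hx)
      have h₂ : r / c ∈ K := by
        apply hK
        rw [mul_comm, pow_mul, div_pow, hr r (Multiset.mem_cons_self r s), hcd]
        norm_num
      rw [Multiset.prod_cons, Multiset.card_cons, pow_succ', mul_div_mul_comm]
      exact mul_mem h₂ h₁
  have hroots : ∀ r ∈ f.roots, r ^ d = 2 := by
    intro r hr
    have h := (mem_roots hf.ne_zero).mp hr
    have h' : (X ^ d - C 2 : K[X]).map (algebraMap K ℂ) |>.IsRoot r :=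
      h.dvd (Polynomial.map_dvd _ hdvd)
    simpa [sub_eq_zero, h2] using h'
  have hmem := hprod f.roots hroots
  have hcard : f.roots.card = (minpoly K c).natDegree := by
    rw [← hs.natDegree_eq_card_roots, natDegree_map]
  have hcoeff : f.coeff 0 = (-1) ^ f.natDegree * f.roots.prod :=
    hs.coeff_zero_eq_prod_roots_of_monic hf
  have hP : f.roots.prod ∈ K := by
    have h₁ : f.roots.prod = (-1) ^ f.natDegree * f.coeff 0 := by
      rw [hcoeff, ← mul_assoc, ← mul_pow]; simp
    rw [h₁]
    refine mul_mem (pow_mem (neg_mem K.one_mem) _) ?_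
    rw [coeff_map]
    exact ((minpoly K c).coeff 0).2
  have hP0 : f.roots.prod ≠ 0 := by
    rw [Ne, Multiset.prod_eq_zero_iff]
    intro h0
    have := hroots 0 h0
    simp [hd] at this
  rw [← hcard]
  have := div_mem hP hmem
  rwa [div_div_cancel₀ hP0] at this

open Polynomial in
/-- A nontrivial relation `∑ i < n, xᵢ cⁱ = 0` over `K` bounds the degree of `c`. -/
lemma exists_pow_mem_of_relation {d : ℕ} (hd : d ≠ 0) {c : ℂ} (hcd : c ^ d = 2)
    {K : IntermediateField ℚ ℂ} (hK : ∀ x : ℂ, x ^ (2 * d) = 1 → x ∈ K) {n : ℕ} {x : Fin n → ℂ}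
    (hx : ∀ i, x i ∈ K) {i : Fin n} (hxi : x i ≠ 0) (h : ∑ i, x i * c ^ (i : ℕ) = 0) :
    ∃ m, 0 < m ∧ m < n ∧ c ^ m ∈ K := by
  set p : K[X] := ∑ i : Fin n, C ⟨x i, hx i⟩ * X ^ (i : ℕ)
  have hp : p.natDegree ≤ n - 1 := natDegree_sum_le_of_forall_le _ _ fun j _ =>
    (natDegree_C_mul_X_pow_le _ _).trans (Nat.le_sub_one_of_lt j.2)
  have hp0 : p ≠ 0 := by
    intro h0
    have hc : p.coeff i = ⟨x i, hx i⟩ := by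
      simp only [p, finsetSum_coeff, coeff_C_mul, coeff_X_pow, Fin.val_inj, mul_ite, mul_one,
        mul_zero, Finset.sum_ite_eq, Finset.mem_univ, if_true]
    rw [h0, coeff_zero] at hc
    exact hxi (congrArg Subtype.val hc).symm
  obtain ⟨m, hm, hmp, hmK⟩ := exists_pow_mem_of_polynomial hd hcd hK hp0 (by
    simpa [p, map_sum] using h)
  exact ⟨m, hm, by have := i.pos; omega, hmK⟩

lemma eq_zero_of_linear_relation {d : ℕ} (hd : 3 < d) {c : ℂ} {K : IntermediateField ℚ ℂ}
    (hj : ∀ j : ℕ, c ^ j ∈ K → d ∣ 2 * j) {x₀ x₁ : ℂ} (h₀ : x₀ ∈ K) (h₁ : x₁ ∈ K)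
    (h : x₀ + x₁ * c = 0) : x₁ = 0 := by
  by_contra hne
  have hc : c = -x₀ / x₁ := by
    rw [eq_div_iff hne]
    linear_combination h
  have := Nat.le_of_dvd (by norm_num) (hj 1 (by
    rw [pow_one, hc]
    exact div_mem (neg_mem h₀) h₁))
  omega

lemma eq_zero_of_quadratic_relation {d : ℕ} (hd : 3 < d) {c : ℂ} (hcd : c ^ d = 2)
    {K : IntermediateField ℚ ℂ} (hK : ∀ x : ℂ, x ^ (2 * d) = 1 → x ∈ K)
    (hj : ∀ j : ℕ, c ^ j ∈ K → d ∣ 2 * j) {x₀ x₁ x₂ : ℂ} (h₀ : x₀ ∈ K) (h₁ : x₁ ∈ K)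
    (h₂ : x₂ ∈ K) (h : x₀ + x₁ * c + x₂ * c ^ 2 = 0) : x₁ = 0 := by
  by_contra hne
  obtain ⟨m, hm, hm3, hmK⟩ := exists_pow_mem_of_relation (by omega) hcd hK
    (x := ![x₀, x₁, x₂]) (i := 1) (by intro i; fin_cases i <;> assumption) hne
    (by simpa [Fin.sum_univ_succ, add_assoc] using h)
  have hle := Nat.le_of_dvd (by omega) (hj m hmK)
  obtain rfl : m = 2 := by omega
  refine hne (eq_zero_of_linear_relation hd hj (add_mem h₀ (mul_mem h₂ hmK)) h₁ ?_)
  linear_combination h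

lemma cubic_relation {d : ℕ} (hd : 3 < d) {c : ℂ} (hcd : c ^ d = 2)
    {K : IntermediateField ℚ ℂ} (hK : ∀ x : ℂ, x ^ (2 * d) = 1 → x ∈ K)
    (hj : ∀ j : ℕ, c ^ j ∈ K → d ∣ 2 * j) {x₀ x₁ x₃ : ℂ} (h₀ : x₀ ∈ K) (h₁ : x₁ ∈ K)
    (h₃ : x₃ ∈ K) (hne : x₃ ≠ 0) (h : x₀ + x₁ * c + x₃ * c ^ 3 = 0) :
    (d = 4 ∧ x₀ = 0) ∨ (d = 6 ∧ x₁ = 0) := by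
  obtain ⟨m, hm, hm4, hmK⟩ := exists_pow_mem_of_relation (by omega) hcd hK
    (x := ![x₀, x₁, 0, x₃]) (i := 3)
    (by intro i; fin_cases i <;> first | assumption | exact K.zero_mem) hne
    (by simpa [Fin.sum_univ_succ, add_assoc] using h)
  have hdvd := hj m hmK
  have hle := Nat.le_of_dvd (by omega) hdvd
  have : m = 2 ∧ d = 4 ∨ m = 3 ∧ d = 6 := by
    have : d ≤ 6 := by omega
    interval_cases m <;> interval_cases d <;> omega
  rcases this with ⟨rfl, rfl⟩ | ⟨rfl, rfl⟩
  · refine Or.inl ⟨rfl, ?_⟩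
    have hx : x₁ + x₃ * c ^ 2 = 0 :=
      eq_zero_of_linear_relation hd hj h₀ (add_mem h₁ (mul_mem h₃ hmK)) (by linear_combination h)
    linear_combination h - c * hx
  · refine Or.inr ⟨rfl, ?_⟩
    exact eq_zero_of_linear_relation hd hj (add_mem h₀ (mul_mem h₃ hmK)) h₁
      (by linear_combination h)

/-- There is a field that contains the `d`-th roots of unity and, up to the factor `c`, the
`d`-th roots of `-2`, and contains `c ^ j` only if `d ∣ 2 * j`. -/
lemma exists_field_of_roots {d : ℕ} (hd : 3 < d) {c : ℝ} (hc : 0 < c) (hcd : c ^ d = 2) :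
    ∃ K : IntermediateField ℚ ℂ, (∀ x : ℂ, x ^ (2 * d) = 1 → x ∈ K) ∧
      (∀ a : ℂ, a ^ d = 1 → a ∈ K) ∧
      (∀ b : ℂ, b ^ d = -2 → ∃ ω ∈ K, ω ≠ 0 ∧ b = ω * c) ∧
      ∀ j : ℕ, (c : ℂ) ^ j ∈ K → d ∣ 2 * j := by
  obtain ⟨K, hK, hj⟩ := exists_cyclotomic_field (by omega) hc hcd
  have hcd' : (c : ℂ) ^ d = 2 := by exact_mod_cast congrArg (fun x : ℝ => (x : ℂ)) hcd
  have hc0 : (c : ℂ) ≠ 0 := by exact_mod_cast hc.ne'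
  refine ⟨K, hK, fun a ha => hK a (by rw [mul_comm, pow_mul, ha, one_pow]), fun b hb => ?_, hj⟩
  have hb0 : b ≠ 0 := by
    rintro rfl
    simp [show d ≠ 0 by omega] at hb
  refine ⟨b / c, hK _ ?_, div_ne_zero hb0 hc0, (div_mul_cancel₀ b hc0).symm⟩
  rw [mul_comm, pow_mul, div_pow, hb, hcd']
  norm_num

lemma mul_ne_of_pow {d : ℕ} {a b b' : ℂ} (ha : a ^ d = 1) (hb : b ^ d = -2)
    (hb' : b' ^ d = -2) : a ≠ b * b' := by
  rintro rfl
  rw [mul_pow, hb, hb'] at ha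
  norm_num at ha

/-- A line through `(a₁ : 1 : b₁)`, `(a₂ : 1 : b₂)` and `(1 : b : a)` only exists when the
first two points agree. -/
lemma eq_of_collinear_next {d : ℕ} (hd : 3 < d) {c : ℝ} (hc : 0 < c) (hcd : c ^ d = 2)
    {p q r a₁ b₁ a₂ b₂ a b : ℂ} (hl : p ≠ 0 ∨ q ≠ 0 ∨ r ≠ 0)
    (ha₁ : a₁ ^ d = 1) (ha₂ : a₂ ^ d = 1) (ha : a ^ d = 1)
    (hb₁ : b₁ ^ d = -2) (hb₂ : b₂ ^ d = -2) (hb : b ^ d = -2)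
    (h₁ : p * a₁ + q * 1 + r * b₁ = 0) (h₂ : p * a₂ + q * 1 + r * b₂ = 0)
    (h₃ : p * 1 + q * b + r * a = 0) : a₁ = a₂ ∧ b₁ = b₂ := by
  have hcd' : (c : ℂ) ^ d = 2 := by exact_mod_cast congrArg (fun x : ℝ => (x : ℂ)) hcd
  have hdet := det_eq_zero hl h₁ h₂ h₃
  obtain ⟨K, hK, hA, hB, hj⟩ := exists_field_of_roots hd hc hcd
  obtain ⟨ω₁, hω₁, -, e₁⟩ := hB b₁ hb₁
  obtain ⟨ω₂, hω₂, -, e₂⟩ := hB b₂ hb₂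
  obtain ⟨ω, hω, -, e⟩ := hB b hb
  have hx := eq_zero_of_quadratic_relation hd hcd' hK hj (x₀ := a * (a₁ - a₂)) (x₁ := ω₂ - ω₁)
    (x₂ := ω * (a₂ * ω₁ - a₁ * ω₂))
    (mul_mem (hA a ha) (sub_mem (hA _ ha₁) (hA _ ha₂))) (sub_mem hω₂ hω₁)
    (mul_mem hω (sub_mem (mul_mem (hA _ ha₂) hω₁) (mul_mem (hA _ ha₁) hω₂)))
    (by rw [e₁, e₂, e] at hdet; linear_combination hdet)
  have hbb : b₁ = b₂ := by rw [e₁, e₂]; linear_combination -(c : ℂ) * hx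
  refine ⟨?_, hbb⟩
  subst hbb
  have hm : (a - b * b₁) * (a₁ - a₂) = 0 := by linear_combination hdet
  exact sub_eq_zero.mp
    ((mul_eq_zero.mp hm).resolve_left (sub_ne_zero.mpr (mul_ne_of_pow ha hb hb₁)))

/-- A line through `(a₁ : 1 : b₁)`, `(a₂ : 1 : b₂)` and `(b : a : 1)` only exists when the
first two points agree. -/
lemma eq_of_collinear_prev {d : ℕ} (hd : 3 < d) {c : ℝ} (hc : 0 < c) (hcd : c ^ d = 2)
    {p q r a₁ b₁ a₂ b₂ a b : ℂ} (hl : p ≠ 0 ∨ q ≠ 0 ∨ r ≠ 0)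
    (ha₁ : a₁ ^ d = 1) (ha₂ : a₂ ^ d = 1) (ha : a ^ d = 1)
    (hb₁ : b₁ ^ d = -2) (hb₂ : b₂ ^ d = -2) (hb : b ^ d = -2)
    (h₁ : p * a₁ + q * 1 + r * b₁ = 0) (h₂ : p * a₂ + q * 1 + r * b₂ = 0)
    (h₃ : p * b + q * a + r * 1 = 0) : a₁ = a₂ ∧ b₁ = b₂ := by
  have hcd' : (c : ℂ) ^ d = 2 := by exact_mod_cast congrArg (fun x : ℝ => (x : ℂ)) hcd
  have ha₁0 : a₁ ≠ 0 := by rintro rfl; simp [show d ≠ 0 by omega] at ha₁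
  have ha0 : a ≠ 0 := by rintro rfl; simp [show d ≠ 0 by omega] at ha
  have hdet := det_eq_zero hl h₁ h₂ h₃
  obtain ⟨K, hK, hA, hB, hj⟩ := exists_field_of_roots hd hc hcd
  obtain ⟨ω₁, hω₁, -, e₁⟩ := hB b₁ hb₁
  obtain ⟨ω₂, hω₂, -, e₂⟩ := hB b₂ hb₂
  obtain ⟨ω, hω, -, e⟩ := hB b hb
  have hx := eq_zero_of_quadratic_relation hd hcd' hK hj (x₀ := a₁ - a₂)
    (x₁ := a * (a₂ * ω₁ - a₁ * ω₂)) (x₂ := ω * (ω₂ - ω₁))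
    (sub_mem (hA _ ha₁) (hA _ ha₂))
    (mul_mem (hA a ha) (sub_mem (mul_mem (hA _ ha₂) hω₁) (mul_mem (hA _ ha₁) hω₂)))
    (mul_mem hω (sub_mem hω₂ hω₁))
    (by rw [e₁, e₂, e] at hdet; linear_combination hdet)
  have hab : a₂ * b₁ = a₁ * b₂ := by
    rw [e₁, e₂]
    linear_combination (c : ℂ) * (mul_eq_zero.mp hx).resolve_left ha0
  have hm : (a₁ - b * b₁) * (a₁ - a₂) = 0 := by
    linear_combination a₁ * hdet + (b - a * a₁) * hab
  have haa : a₁ = a₂ := sub_eq_zero.mp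
    ((mul_eq_zero.mp hm).resolve_left (sub_ne_zero.mpr (mul_ne_of_pow ha₁ hb hb₁)))
  refine ⟨haa, mul_left_cancel₀ ha₁0 ?_⟩
  rw [← hab, haa]

lemma fourth_root_cases {j : ℂ} (h : j ^ 4 = 1) :
    j = 1 ∨ j = -1 ∨ j = Complex.I ∨ j = -Complex.I := by
  have : (j - 1) * ((j + 1) * ((j - Complex.I) * (j + Complex.I))) = 0 := by
    linear_combination h - (j ^ 2 - 1) * Complex.I_sq
  rcases mul_eq_zero.mp this with h | h
  · exact Or.inl (sub_eq_zero.mp h)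
  rcases mul_eq_zero.mp h with h | h
  · exact Or.inr (Or.inl (eq_neg_of_add_eq_zero_left h))
  rcases mul_eq_zero.mp h with h | h
  · exact Or.inr (Or.inr (Or.inl (sub_eq_zero.mp h)))
  · exact Or.inr (Or.inr (Or.inr (eq_neg_of_add_eq_zero_left h)))

lemma one_add_fourth_roots_pow_ne {j k : ℂ} (hj : j ^ 4 = 1) (hk : k ^ 4 = 1) :
    (1 + j + k) ^ 4 ≠ 4 := by
  intro h
  have hn := congrArg Complex.normSq h
  rw [map_pow] at hn
  rcases fourth_root_cases hj with rfl | rfl | rfl | rfl <;>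
    rcases fourth_root_cases hk with rfl | rfl | rfl | rfl <;>
    norm_num [Complex.normSq_apply] at hn

lemma sum_ne_of_fourth_power {P Q R : ℂ} (hP : P ^ 4 = -2) (hQ : Q ^ 4 = -2) (hR : R ^ 4 = -2) :
    P + Q + R ≠ -(P * Q * R) := by
  intro h
  have hP0 : P ≠ 0 := by rintro rfl; norm_num at hP
  have hj : (Q / P) ^ 4 = 1 := by rw [div_pow, hP, hQ]; norm_num
  have hk : (R / P) ^ 4 = 1 := by rw [div_pow, hP, hR]; norm_num
  refine one_add_fourth_roots_pow_ne hj hk ?_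
  have e : 1 + Q / P + R / P = -(Q * R) := by
    field_simp
    linear_combination h
  rw [e, neg_pow, mul_pow, hQ, hR]
  norm_num

lemma one_add_sixth_root_pow_ne {u : ℂ} (hu : u ^ 6 = 1) : (1 + u) ^ 6 ≠ -8 := by
  intro h
  have : (u - 1) * ((u + 1) * ((u ^ 2 + u + 1) * (u ^ 2 - u + 1))) = 0 := by
    linear_combination hu
  rcases mul_eq_zero.mp this with h' | h'
  · rw [sub_eq_zero.mp h'] at h
    norm_num at h
  rcases mul_eq_zero.mp h' with h' | h'
  · rw [eq_neg_of_add_eq_zero_left h'] at h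
    norm_num at h
  rcases mul_eq_zero.mp h' with h' | h'
  · have e : 1 + u = -u ^ 2 := by linear_combination h'
    have : (1 + u) ^ 6 = 1 := by
      rw [e]
      linear_combination (u ^ 6 + 1) * hu
    rw [this] at h
    norm_num at h
  · have e : (1 + u) ^ 2 = 3 * u := by linear_combination h'
    have e3 : u ^ 3 = -1 := by linear_combination (u + 1) * h'
    have : (1 + u) ^ 6 = -27 := by
      calc (1 + u) ^ 6 = ((1 + u) ^ 2) ^ 3 := by ring
        _ = 27 * u ^ 3 := by rw [e]; ring
        _ = -27 := by rw [e3]; norm_num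
    rw [this] at h
    norm_num at h

/-- Sextactic points `(a₁ : 1 : b₁)`, `(1 : b₂ : a₂)`, `(b₃ : a₃ : 1)` are never collinear. -/
lemma not_collinear_of_three_types {d : ℕ} (hd : 3 < d) {c : ℝ} (hc : 0 < c)
    (hcd : c ^ d = 2) {p q r a₁ b₁ a₂ b₂ a₃ b₃ : ℂ} (hl : p ≠ 0 ∨ q ≠ 0 ∨ r ≠ 0)
    (ha₁ : a₁ ^ d = 1) (ha₂ : a₂ ^ d = 1) (ha₃ : a₃ ^ d = 1)
    (hb₁ : b₁ ^ d = -2) (hb₂ : b₂ ^ d = -2) (hb₃ : b₃ ^ d = -2)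
    (h₁ : p * a₁ + q * 1 + r * b₁ = 0) (h₂ : p * 1 + q * b₂ + r * a₂ = 0)
    (h₃ : p * b₃ + q * a₃ + r * 1 = 0) : False := by
  have hcd' : (c : ℂ) ^ d = 2 := by exact_mod_cast congrArg (fun x : ℝ => (x : ℂ)) hcd
  have hdet := det_eq_zero hl h₁ h₂ h₃
  obtain ⟨K, hK, hA, hB, hj⟩ := exists_field_of_roots hd hc hcd
  obtain ⟨ω₁, hω₁, n₁, e₁⟩ := hB b₁ hb₁
  obtain ⟨ω₂, hω₂, n₂, e₂⟩ := hB b₂ hb₂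
  obtain ⟨ω₃, hω₃, n₃, e₃⟩ := hB b₃ hb₃
  have hA₁ := hA a₁ ha₁
  have hA₂ := hA a₂ ha₂
  have hA₃ := hA a₃ ha₃
  have hx := cubic_relation hd hcd' hK hj (x₀ := -(1 + a₁ * a₂ * a₃))
    (x₁ := a₁ * ω₂ + a₂ * ω₃ + a₃ * ω₁) (x₃ := -(ω₁ * ω₂ * ω₃))
    (neg_mem (add_mem K.one_mem (mul_mem (mul_mem hA₁ hA₂) hA₃)))
    (add_mem (add_mem (mul_mem hA₁ hω₂) (mul_mem hA₂ hω₃)) (mul_mem hA₃ hω₁))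
    (neg_mem (mul_mem (mul_mem hω₁ hω₂) hω₃))
    (neg_ne_zero.mpr (mul_ne_zero (mul_ne_zero n₁ n₂) n₃))
    (by rw [e₁, e₂, e₃] at hdet; linear_combination hdet)
  rcases hx with ⟨rfl, hx⟩ | ⟨rfl, hx⟩
  · refine sum_ne_of_fourth_power (P := a₁ * b₂) (Q := a₂ * b₃) (R := a₃ * b₁)
      (by rw [mul_pow, ha₁, hb₂, one_mul]) (by rw [mul_pow, ha₂, hb₃, one_mul])
      (by rw [mul_pow, ha₃, hb₁, one_mul]) ?_
    linear_combination hdet - (1 + b₁ * b₂ * b₃) * hx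
  · refine one_add_sixth_root_pow_ne (u := a₁ * a₂ * a₃)
      (by rw [mul_pow, mul_pow, ha₁, ha₂, ha₃]; norm_num) ?_
    have e : 1 + a₁ * a₂ * a₃ = -(b₁ * b₂ * b₃) := by
      have hx' : a₁ * b₂ + a₂ * b₃ + a₃ * b₁ = 0 := by
        rw [e₁, e₂, e₃]
        linear_combination (c : ℂ) * hx
      linear_combination hx' - hdet
    rw [e, neg_pow, mul_pow, mul_pow, hb₁, hb₂, hb₃]
    norm_num

lemma eq_of_collinear_of_same_type {d : ℕ} (hd : 3 < d) {c : ℝ} (hc : 0 < c) (hcd : c ^ d = 2)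
    {l : Fin 3 → ℂ} (hl : l 0 ≠ 0 ∨ l 1 ≠ 0 ∨ l 2 ≠ 0)
    {a b a' b' a'' b'' : ℂ} {v v' v'' : Fin 3 → ℂ}
    (ha : a ^ d = 1) (hb : b ^ d = -2) (ha' : a' ^ d = 1) (hb' : b' ^ d = -2)
    (ha'' : a'' ^ d = 1) (hb'' : b'' ^ d = -2)
    (h : l 0 * v 0 + l 1 * v 1 + l 2 * v 2 = 0)
    (h' : l 0 * v' 0 + l 1 * v' 1 + l 2 * v' 2 = 0)
    (h'' : l 0 * v'' 0 + l 1 * v'' 1 + l 2 * v'' 2 = 0)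
    (hv : (v = ![a, 1, b] ∧ v' = ![a', 1, b'] ∧ (v'' = ![1, b'', a''] ∨ v'' = ![b'', a'', 1])) ∨
      (v = ![1, b, a] ∧ v' = ![1, b', a'] ∧ (v'' = ![b'', a'', 1] ∨ v'' = ![a'', 1, b''])) ∨
      (v = ![b, a, 1] ∧ v' = ![b', a', 1] ∧ (v'' = ![a'', 1, b''] ∨ v'' = ![1, b'', a'']))) :
    v = v' := by
  have hl₁ : l 1 ≠ 0 ∨ l 2 ≠ 0 ∨ l 0 ≠ 0 := by tauto
  have hl₂ : l 2 ≠ 0 ∨ l 0 ≠ 0 ∨ l 1 ≠ 0 := by tauto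
  rcases hv with ⟨rfl, rfl, rfl | rfl⟩ | ⟨rfl, rfl, rfl | rfl⟩ | ⟨rfl, rfl, rfl | rfl⟩ <;>
    simp only [Matrix.cons_val] at h h' h''
  · obtain ⟨rfl, rfl⟩ := eq_of_collinear_next hd hc hcd hl ha ha' ha'' hb hb' hb'' h h' h''
    rfl
  · obtain ⟨rfl, rfl⟩ := eq_of_collinear_prev hd hc hcd hl ha ha' ha'' hb hb' hb'' h h' h''
    rfl
  · obtain ⟨rfl, rfl⟩ := eq_of_collinear_next hd hc hcd hl₂ ha ha' ha'' hb hb' hb''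
      (by linear_combination h) (by linear_combination h') (by linear_combination h'')
    rfl
  · obtain ⟨rfl, rfl⟩ := eq_of_collinear_prev hd hc hcd hl₂ ha ha' ha'' hb hb' hb''
      (by linear_combination h) (by linear_combination h') (by linear_combination h'')
    rfl
  · obtain ⟨rfl, rfl⟩ := eq_of_collinear_next hd hc hcd hl₁ ha ha' ha'' hb hb' hb''
      (by linear_combination h) (by linear_combination h') (by linear_combination h'')
    rfl
  · obtain ⟨rfl, rfl⟩ := eq_of_collinear_prev hd hc hcd hl₁ ha ha' ha'' hb hb' hb''
      (by linear_combination h) (by linear_combination h') (by linear_combination h'')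
    rfl

/-- Let `d > 3` and `c` the positive real `d`-th root of `2`.  If a line of `ℙ²(ℂ)`, with
coefficient vector `l ≠ 0` (the line being `l₀x + l₁y + l₂z = 0`), contains at least three
distinct sextactic points of the Fermat curve `F_d`, then it is one of the `9d` lines of
`B ∪ M ∪ N`: it has an equation `x = αy`, `y = αz` or `z = αx` with `α^d = 1`, or
`z = βy`, `x = βz`, `y = βx`, `y = βz`, `z = βx` or `x = βy` with `β^d = -2`. -/
theorem fermat_lines_through_three_sextactic (d : ℕ) (hd : 3 < d)
    (c : ℝ) (hc : 0 < c) (hcd : c ^ d = 2)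
    (l : Fin 3 → ℂ) (hl : l ≠ 0)
    (v₁ v₂ v₃ : Fin 3 → ℂ)
    (hv₁ : IsSextacticVec d v₁) (hv₂ : IsSextacticVec d v₂) (hv₃ : IsSextacticVec d v₃)
    (h12 : v₁ ≠ v₂) (h13 : v₁ ≠ v₃) (h23 : v₂ ≠ v₃)
    (hl₁ : l 0 * v₁ 0 + l 1 * v₁ 1 + l 2 * v₁ 2 = 0)
    (hl₂ : l 0 * v₂ 0 + l 1 * v₂ 1 + l 2 * v₂ 2 = 0)
    (hl₃ : l 0 * v₃ 0 + l 1 * v₃ 1 + l 2 * v₃ 2 = 0) :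
    ∃ t : ℂ, t ≠ 0 ∧
      ((∃ α : ℂ, α ^ d = 1 ∧
          (l = t • ![1, -α, 0] ∨ l = t • ![0, 1, -α] ∨ l = t • ![-α, 0, 1])) ∨
       (∃ β : ℂ, β ^ d = -2 ∧
          (l = t • ![0, -β, 1] ∨ l = t • ![1, 0, -β] ∨ l = t • ![-β, 1, 0] ∨
           l = t • ![0, 1, -β] ∨ l = t • ![-β, 0, 1] ∨ l = t • ![1, -β, 0]))) := by
  have hd0 : d ≠ 0 := by omega
  have hl₀₁₂ : l 0 ≠ 0 ∨ l 1 ≠ 0 ∨ l 2 ≠ 0 := by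
    by_contra! ⟨h0, h1, h2⟩
    exact hl (funext fun i => by fin_cases i <;> assumption)
  have hl₁₂₀ : l 1 ≠ 0 ∨ l 2 ≠ 0 ∨ l 0 ≠ 0 := by tauto
  have hl₂₀₁ : l 2 ≠ 0 ∨ l 0 ≠ 0 ∨ l 1 ≠ 0 := by tauto
  have ext_l : ∀ {x y z : ℂ}, l 0 = x → l 1 = y → l 2 = z → l = ![x, y, z] := by
    intro x y z hx hy hz
    funext i
    fin_cases i <;> assumption
  obtain ⟨a₁, b₁, ha₁, hb₁, hw₁⟩ := hv₁
  obtain ⟨a₂, b₂, ha₂, hb₂, hw₂⟩ := hv₂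
  obtain ⟨a₃, b₃, ha₃, hb₃, hw₃⟩ := hv₃
  have triple : ∀ {a b a' b' a'' b'' : ℂ} {v v' v'' : Fin 3 → ℂ},
      a ^ d = 1 → b ^ d = -2 → a' ^ d = 1 → b' ^ d = -2 → a'' ^ d = 1 → b'' ^ d = -2 →
      l 0 * v 0 + l 1 * v 1 + l 2 * v 2 = 0 → l 0 * v' 0 + l 1 * v' 1 + l 2 * v' 2 = 0 →
      l 0 * v'' 0 + l 1 * v'' 1 + l 2 * v'' 2 = 0 →
      v = ![a, 1, b] → v' = ![1, b', a'] → v'' = ![b'', a'', 1] → False := by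
    rintro a b a' b' a'' b'' v v' v'' ha hb ha' hb' ha'' hb'' h h' h'' rfl rfl rfl
    exact not_collinear_of_three_types hd hc hcd hl₀₁₂ ha ha' ha'' hb hb' hb'' h h' h''
  have p12 := mt (eq_of_collinear_of_same_type hd hc hcd hl₀₁₂ ha₁ hb₁ ha₂ hb₂ ha₃ hb₃
    hl₁ hl₂ hl₃) h12
  have p13 := mt (eq_of_collinear_of_same_type hd hc hcd hl₀₁₂ ha₁ hb₁ ha₃ hb₃ ha₂ hb₂
    hl₁ hl₃ hl₂) h13
  have p23 := mt (eq_of_collinear_of_same_type hd hc hcd hl₀₁₂ ha₂ hb₂ ha₃ hb₃ ha₁ hb₁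
    hl₂ hl₃ hl₁) h23
  have t123 := triple ha₁ hb₁ ha₂ hb₂ ha₃ hb₃ hl₁ hl₂ hl₃
  have t132 := triple ha₁ hb₁ ha₃ hb₃ ha₂ hb₂ hl₁ hl₃ hl₂
  have t213 := triple ha₂ hb₂ ha₁ hb₁ ha₃ hb₃ hl₂ hl₁ hl₃
  have t231 := triple ha₂ hb₂ ha₃ hb₃ ha₁ hb₁ hl₂ hl₃ hl₁
  have t312 := triple ha₃ hb₃ ha₁ hb₁ ha₂ hb₂ hl₃ hl₁ hl₂
  have t321 := triple ha₃ hb₃ ha₂ hb₂ ha₁ hb₁ hl₃ hl₂ hl₁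
  have same : (v₁ = ![a₁, 1, b₁] ∧ v₂ = ![a₂, 1, b₂] ∧ v₃ = ![a₃, 1, b₃]) ∨
      (v₁ = ![1, b₁, a₁] ∧ v₂ = ![1, b₂, a₂] ∧ v₃ = ![1, b₃, a₃]) ∨
      (v₁ = ![b₁, a₁, 1] ∧ v₂ = ![b₂, a₂, 1] ∧ v₃ = ![b₃, a₃, 1]) := by
    rcases hw₁ with h₁ | h₁ | h₁ <;> rcases hw₂ with h₂ | h₂ | h₂ <;>
      rcases hw₃ with h₃ | h₃ | h₃ <;>
    first
    | exact Or.inl ⟨h₁, h₂, h₃⟩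
    | exact Or.inr (Or.inl ⟨h₁, h₂, h₃⟩)
    | exact Or.inr (Or.inr ⟨h₁, h₂, h₃⟩)
    | exact (t123 h₁ h₂ h₃).elim
    | exact (t132 h₁ h₃ h₂).elim
    | exact (t213 h₂ h₁ h₃).elim
    | exact (t231 h₂ h₃ h₁).elim
    | exact (t312 h₃ h₁ h₂).elim
    | exact (t321 h₃ h₂ h₁).elim
    | (refine absurd ?_ p12; simp only [h₁, h₂, h₃, true_and, true_or, or_true]; done)
    | (refine absurd ?_ p13; simp only [h₁, h₂, h₃, true_and, true_or, or_true]; done)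
    | (refine absurd ?_ p23; simp only [h₁, h₂, h₃, true_and, true_or, or_true])
  clear p12 p13 p23 t123 t132 t213 t231 t312 t321 hw₁ hw₂ hw₃ triple
  rcases same with ⟨rfl, rfl, rfl⟩ | ⟨rfl, rfl, rfl⟩ | ⟨rfl, rfl, rfl⟩ <;>
    simp only [Matrix.cons_val] at hl₁ hl₂ hl₃
  · obtain ⟨t, ht, h⟩ := line_form_of_same_type hd0 hc hcd hl₀₁₂ ha₁ ha₂ ha₃ hb₁ hb₂ hb₃
      (fun h => h12 (by rw [h.1, h.2])) (fun h => h13 (by rw [h.1, h.2]))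
      (fun h => h23 (by rw [h.1, h.2])) (by linear_combination hl₁) (by linear_combination hl₂)
      (by linear_combination hl₃)
    refine ⟨t, ht, ?_⟩
    rcases h with ⟨α, hα, hp, hq, hr⟩ | ⟨β, hβ, ⟨hp, hq, hr⟩ | ⟨hp, hq, hr⟩⟩
    · exact Or.inl ⟨α, hα, Or.inl (by simp [ext_l hp hq hr])⟩
    · exact Or.inr ⟨β, hβ, Or.inl (by simp [ext_l hp hq hr])⟩
    · exact Or.inr ⟨β, hβ, by simp [ext_l hp hq hr]⟩
  · obtain ⟨t, ht, h⟩ := line_form_of_same_type hd0 hc hcd hl₂₀₁ ha₁ ha₂ ha₃ hb₁ hb₂ hb₃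
      (fun h => h12 (by rw [h.1, h.2])) (fun h => h13 (by rw [h.1, h.2]))
      (fun h => h23 (by rw [h.1, h.2])) (by linear_combination hl₁) (by linear_combination hl₂)
      (by linear_combination hl₃)
    refine ⟨t, ht, ?_⟩
    rcases h with ⟨α, hα, hp, hq, hr⟩ | ⟨β, hβ, ⟨hp, hq, hr⟩ | ⟨hp, hq, hr⟩⟩
    · exact Or.inl ⟨α, hα, by simp [ext_l hq hr hp]⟩
    · exact Or.inr ⟨β, hβ, by simp [ext_l hq hr hp]⟩
    · exact Or.inr ⟨β, hβ, by simp [ext_l hq hr hp]⟩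
  · obtain ⟨t, ht, h⟩ := line_form_of_same_type hd0 hc hcd hl₁₂₀ ha₁ ha₂ ha₃ hb₁ hb₂ hb₃
      (fun h => h12 (by rw [h.1, h.2])) (fun h => h13 (by rw [h.1, h.2]))
      (fun h => h23 (by rw [h.1, h.2])) (by linear_combination hl₁) (by linear_combination hl₂)
      (by linear_combination hl₃)
    refine ⟨t, ht, ?_⟩
    rcases h with ⟨α, hα, hp, hq, hr⟩ | ⟨β, hβ, ⟨hp, hq, hr⟩ | ⟨hp, hq, hr⟩⟩
    · exact Or.inl ⟨α, hα, by simp [ext_l hr hp hq]⟩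
    · exact Or.inr ⟨β, hβ, by simp [ext_l hr hp hq]⟩
    · exact Or.inr ⟨β, hβ, by simp [ext_l hr hp hq]⟩
end

section
/- Let d ≥ 3. (i) For P = (x^d − y^d)(z^d + 2y^d)(z^d + 2x^d), the module AR(P) of Jacobian syzygies is a free module over S = ℂ[x,y,z] admitting a basis of two syzygies whose components are homogeneous of degrees d+1 and 2d−2, respectively; i.e., the curve B_z ∪ M_x ∪ N_y of degree 3d is free with exponents (d+1, 2d−2). (ii) For P = xyz·(x^d − y^d)(z^d + 2y^d)(z^d + 2x^d), AR(P) is free with a homogeneous basis of degrees d+1 and 2d+1; i.e., V(xyz) ∪ B_z ∪ M_x ∪ N_y of degree 3d+3 is free with exponents (d+1, 2d+1). (iii) For P = (x^d + y^d + z^d)(x^d − y^d)(z^d + 2y^d)(z^d + 2x^d), AR(P) is free with a homogeneous basis of degrees 2d−2 and 2d+1; i.e., F_d ∪ B_z ∪ M_x ∪ N_y of degree 4d is free with exponents (2d−2, 2d+1). -/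
open MvPolynomial

/-- `g = (a,b,c) ∈ S³` is a Jacobian syzygy of `P ∈ S = ℂ[x,y,z]`, i.e. an element of
`AR(P) = {(a,b,c) : a·P_x + b·P_y + c·P_z = 0}`. -/
def IsJacobianSyzygy (P : MvPolynomial (Fin 3) ℂ) (g : Fin 3 → MvPolynomial (Fin 3) ℂ) :
    Prop :=
  g 0 * pderiv 0 P + g 1 * pderiv 1 P + g 2 * pderiv 2 P = 0

/-- `AR(P)` is a free `S`-module with a basis of two syzygies whose components are
homogeneous of degrees `r₁` and `r₂` respectively, i.e. the curve `V(P)` is free with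
exponents `(r₁, r₂)`. -/
def IsFreeWithExponents (P : MvPolynomial (Fin 3) ℂ) (r₁ r₂ : ℕ) : Prop :=
  ∃ e₁ e₂ : Fin 3 → MvPolynomial (Fin 3) ℂ,
    IsJacobianSyzygy P e₁ ∧ IsJacobianSyzygy P e₂ ∧
    (∀ i, (e₁ i).IsHomogeneous r₁) ∧ (∀ i, (e₂ i).IsHomogeneous r₂) ∧
    ∀ g : Fin 3 → MvPolynomial (Fin 3) ℂ, IsJacobianSyzygy P g →
      ∃! ab : MvPolynomial (Fin 3) ℂ × MvPolynomial (Fin 3) ℂ,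
        g = fun i => ab.1 * e₁ i + ab.2 * e₂ i

/-- If `a ∣ s * f i` for all `i` and no prime divides every `f i`, then `a ∣ s`. -/
theorem dvd_of_forall_dvd_mul {R ι : Type*} [CommRing R] [IsDomain R]
    [UniqueFactorizationMonoid R] {f : ι → R} (hf : ∀ p, Prime p → ¬ ∀ i, p ∣ f i)
    {a : R} (ha : a ≠ 0) {s : R} (h : ∀ i, a ∣ s * f i) : a ∣ s := by
  induction a using UniqueFactorizationMonoid.induction_on_prime generalizing s with
  | h₁ => exact absurd rfl ha
  | h₂ x hx => exact hx.dvd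
  | h₃ a p ha' hp ih =>
    obtain ⟨i, hi⟩ := not_forall.mp (hf p hp)
    obtain ⟨t, rfl⟩ := (hp.dvd_or_dvd ((dvd_mul_right p a).trans (h i))).resolve_right hi
    refine mul_dvd_mul_left p (ih ha' fun j => ?_)
    have hj := h j
    rw [mul_assoc] at hj
    exact (mul_dvd_mul_iff_left hp.ne_zero).mp hj

/-- A vector proportional to a vector `f` whose entries have no common prime factor is a
multiple of `f`. -/
theorem exists_eq_mul_of_proportional {R ι : Type*} [CommRing R] [IsDomain R]
    [UniqueFactorizationMonoid R] {f m : ι → R} (hf : ∀ p, Prime p → ¬ ∀ i, p ∣ f i)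
    {i : ι} (hi : f i ≠ 0) (h : ∀ i j, m i * f j = m j * f i) : ∃ a, ∀ j, m j = a * f j := by
  obtain ⟨a, ha⟩ := dvd_of_forall_dvd_mul hf hi (s := m i)
    fun j => ⟨m j, by rw [h i j, mul_comm]⟩
  refine ⟨a, fun j => mul_right_cancel₀ hi ?_⟩
  rw [← h i j, ha]
  ring

/-- A version of Saito's criterion: if the cross product of `e₁` and `e₂` is a unit multiple of
the gradient of `P` and the partial derivatives of `P` have no common prime factor, then
`e₁` and `e₂` form a basis of the module of Jacobian syzygies of `P`. -/
theorem isFreeWithExponents_of_cross {P c : MvPolynomial (Fin 3) ℂ}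
    {e₁ e₂ : Fin 3 → MvPolynomial (Fin 3) ℂ} {r₁ r₂ : ℕ} (hc : IsUnit c)
    (hP : ∀ p, Prime p → ¬ ∀ i, p ∣ pderiv i P)
    (h0 : e₁ 1 * e₂ 2 - e₁ 2 * e₂ 1 = c * pderiv 0 P)
    (h1 : e₁ 2 * e₂ 0 - e₁ 0 * e₂ 2 = c * pderiv 1 P)
    (h2 : e₁ 0 * e₂ 1 - e₁ 1 * e₂ 0 = c * pderiv 2 P)
    (hr₁ : ∀ i, (e₁ i).IsHomogeneous r₁) (hr₂ : ∀ i, (e₂ i).IsHomogeneous r₂) :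
    IsFreeWithExponents P r₁ r₂ := by
  have hc0 := hc.ne_zero
  obtain ⟨k, hk⟩ : ∃ k, pderiv k P ≠ 0 := by
    by_contra! h
    exact hP (X 0) (X_prime) fun i => h i ▸ dvd_zero _
  have hzero : ∀ h : MvPolynomial (Fin 3) ℂ, (∀ i, h * pderiv i P = 0) → h = 0 :=
    fun h hh => (mul_eq_zero.mp (hh k)).resolve_right hk
  have hs₁ : e₁ 0 * pderiv 0 P + e₁ 1 * pderiv 1 P + e₁ 2 * pderiv 2 P = 0 :=
    mul_left_cancel₀ hc0 <| by
      linear_combination (-e₁ 0) * h0 - e₁ 1 * h1 - e₁ 2 * h2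
  have hs₂ : e₂ 0 * pderiv 0 P + e₂ 1 * pderiv 1 P + e₂ 2 * pderiv 2 P = 0 :=
    mul_left_cancel₀ hc0 <| by
      linear_combination (-e₂ 0) * h0 - e₂ 1 * h1 - e₂ 2 * h2
  refine ⟨e₁, e₂, hs₁, hs₂, hr₁, hr₂, fun g hg => ?_⟩
  unfold IsJacobianSyzygy at hg
  obtain ⟨u, hu⟩ := hc.exists_left_inv
  have key : ∀ a b : Fin 3 → MvPolynomial (Fin 3) ℂ,
      a 0 * pderiv 0 P + a 1 * pderiv 1 P + a 2 * pderiv 2 P = 0 →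
      b 0 * pderiv 0 P + b 1 * pderiv 1 P + b 2 * pderiv 2 P = 0 →
      ∃ t, a 1 * b 2 - a 2 * b 1 = t * c * pderiv 0 P ∧
        a 2 * b 0 - a 0 * b 2 = t * c * pderiv 1 P ∧
        a 0 * b 1 - a 1 * b 0 = t * c * pderiv 2 P := by
    intro a b ha hb
    have H01 : (a 1 * b 2 - a 2 * b 1) * pderiv 1 P = (a 2 * b 0 - a 0 * b 2) * pderiv 0 P := by
      linear_combination b 2 * ha - a 2 * hb
    have H02 : (a 1 * b 2 - a 2 * b 1) * pderiv 2 P = (a 0 * b 1 - a 1 * b 0) * pderiv 0 P := by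
      linear_combination a 1 * hb - b 1 * ha
    have H12 : (a 2 * b 0 - a 0 * b 2) * pderiv 2 P = (a 0 * b 1 - a 1 * b 0) * pderiv 1 P := by
      linear_combination b 0 * ha - a 0 * hb
    obtain ⟨t, ht⟩ := exists_eq_mul_of_proportional (f := fun i => pderiv i P)
      (m := ![a 1 * b 2 - a 2 * b 1, a 2 * b 0 - a 0 * b 2, a 0 * b 1 - a 1 * b 0]) hP hk
      (by simp [Fin.forall_fin_succ, H01, H02, H12])
    refine ⟨t * u, ?_, ?_, ?_⟩
    · rw [mul_assoc t, hu, mul_one]; exact ht 0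
    · rw [mul_assoc t, hu, mul_one]; exact ht 1
    · rw [mul_assoc t, hu, mul_one]; exact ht 2
  obtain ⟨α, α0, α1, α2⟩ := key g e₂ hg hs₂
  obtain ⟨β, β0, β1, β2⟩ := key e₁ g hs₁ hg
  refine ⟨(α, β), ?_, ?_⟩
  · set h : Fin 3 → MvPolynomial (Fin 3) ℂ := fun i => g i - (α * e₁ i + β * e₂ i)
    have hdef : ∀ i, h i = g i - (α * e₁ i + β * e₂ i) := fun i => rfl
    have D : ∀ i j, h i * e₂ j = h j * e₂ i := by
      have D01 : h 0 * e₂ 1 = h 1 * e₂ 0 := by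
        rw [hdef, hdef]; linear_combination α2 - α * h2
      have D02 : h 0 * e₂ 2 = h 2 * e₂ 0 := by
        rw [hdef, hdef]; linear_combination α * h1 - α1
      have D12 : h 1 * e₂ 2 = h 2 * e₂ 1 := by
        rw [hdef, hdef]; linear_combination α0 - α * h0
      simp [Fin.forall_fin_succ, D01, D02, D12]
    have Y : ∀ i j, e₁ i * h j = e₁ j * h i := by
      have Y01 : e₁ 0 * h 1 = e₁ 1 * h 0 := by
        rw [hdef, hdef]; linear_combination β2 - β * h2
      have Y02 : e₁ 0 * h 2 = e₁ 2 * h 0 := by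
        rw [hdef, hdef]; linear_combination β * h1 - β1
      have Y12 : e₁ 1 * h 2 = e₁ 2 * h 1 := by
        rw [hdef, hdef]; linear_combination β0 - β * h0
      simp [Fin.forall_fin_succ, Y01, Y02, Y12]
    have hN : ∀ i j k, h i * (e₁ j * e₂ k - e₁ k * e₂ j) = 0 := fun i j k => by
      linear_combination e₁ j * D i k - e₁ k * D i j + e₂ i * Y j k
    funext i
    refine sub_eq_zero.mp (hzero (h i) fun j => mul_left_cancel₀ hc0 ?_)
    fin_cases j
    · change c * (h i * pderiv 0 P) = c * 0
      linear_combination hN i 1 2 - h i * h0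
    · change c * (h i * pderiv 1 P) = c * 0
      linear_combination hN i 2 0 - h i * h1
    · change c * (h i * pderiv 2 P) = c * 0
      linear_combination hN i 0 1 - h i * h2
  · rintro ⟨a, b⟩ hab
    have g0 : g 0 = a * e₁ 0 + b * e₂ 0 := congrFun hab 0
    have g1 : g 1 = a * e₁ 1 + b * e₂ 1 := congrFun hab 1
    have g2 : g 2 = a * e₁ 2 + b * e₂ 2 := congrFun hab 2
    simp only [g0, g1, g2] at α0 α1 α2 β0 β1 β2
    have ha : a - α = 0 := hzero _ <| by
      intro i
      apply mul_left_cancel₀ hc0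
      fin_cases i
      · change c * ((a - α) * pderiv 0 P) = c * 0
        linear_combination α0 - a * h0
      · change c * ((a - α) * pderiv 1 P) = c * 0
        linear_combination α1 - a * h1
      · change c * ((a - α) * pderiv 2 P) = c * 0
        linear_combination α2 - a * h2
    have hb : b - β = 0 := hzero _ <| by
      intro i
      apply mul_left_cancel₀ hc0
      fin_cases i
      · change c * ((b - β) * pderiv 0 P) = c * 0
        linear_combination β0 - b * h0
      · change c * ((b - β) * pderiv 1 P) = c * 0
        linear_combination β1 - b * h1
      · change c * ((b - β) * pderiv 2 P) = c * 0
        linear_combination β2 - b * h2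
    rw [Prod.mk.injEq]
    exact ⟨sub_eq_zero.mp ha, sub_eq_zero.mp hb⟩

theorem isUnit_natCast {k : ℕ} (hk : k ≠ 0) : IsUnit (k : MvPolynomial (Fin 3) ℂ) := by
  rw [← map_natCast (C : ℂ →+* MvPolynomial (Fin 3) ℂ)]
  exact (isUnit_iff_ne_zero.mpr (Nat.cast_ne_zero.mpr hk)).map C

/-- The curve `V(Q)` has no multiple component: no prime divides `Q` and all its partial
derivatives. -/
def NoMultipleComponent (Q : MvPolynomial (Fin 3) ℂ) : Prop :=
  ∀ p, Prime p → p ∣ Q → ¬ ∀ i, p ∣ pderiv i Q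

theorem NoMultipleComponent.mul {Q₁ Q₂ : MvPolynomial (Fin 3) ℂ}
    (h₁ : NoMultipleComponent Q₁) (h₂ : NoMultipleComponent Q₂)
    (h : ∀ p, Prime p → p ∣ Q₁ → ¬ p ∣ Q₂) : NoMultipleComponent (Q₁ * Q₂) := by
  intro p hp hpQ hd
  simp only [Derivation.leibniz, smul_eq_mul] at hd
  rcases hp.dvd_or_dvd hpQ with hQ | hQ
  · refine h₁ p hp hQ fun i => ?_
    have := (dvd_add_right (hQ.mul_right _)).mp (hd i)
    exact (hp.dvd_or_dvd this).resolve_left (h p hp hQ)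
  · refine h₂ p hp hQ fun i => ?_
    have := (dvd_add_left (hQ.mul_right _)).mp (hd i)
    exact (hp.dvd_or_dvd this).resolve_left fun hQ' => h p hp hQ' hQ

theorem NoMultipleComponent.not_forall_dvd_pderiv {Q : MvPolynomial (Fin 3) ℂ}
    (hQ : NoMultipleComponent Q) {k : ℕ} (hk : k ≠ 0) (hom : Q.IsHomogeneous k)
    (p : MvPolynomial (Fin 3) ℂ) (hp : Prime p) : ¬ ∀ i, p ∣ pderiv i Q := by
  intro h
  refine hQ p hp ?_ h
  have hE := hom.sum_X_mul_pderiv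
  have hs : p ∣ k • Q := hE ▸ Finset.dvd_sum fun i _ => (h i).mul_left _
  rw [nsmul_eq_mul] at hs
  exact (isUnit_natCast hk).dvd_mul_left.mp hs

theorem degreeOf_eq_zero_of_dvd {i : Fin 3} {p q : MvPolynomial (Fin 3) ℂ} (hq : q ≠ 0)
    (h : q.degreeOf i = 0) (hpq : p ∣ q) : p.degreeOf i = 0 := by
  obtain ⟨r, rfl⟩ := hpq
  rw [degreeOf_mul_eq (left_ne_zero_of_mul hq) (right_ne_zero_of_mul hq)] at h
  omega

/-- No prime divides, for each variable, a nonzero polynomial not involving that variable. -/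
theorem not_prime_of_forall_dvd {p : MvPolynomial (Fin 3) ℂ} (hp : Prime p)
    (h : ∀ i, ∃ q, q ≠ 0 ∧ degreeOf i q = 0 ∧ p ∣ q) : False := by
  have ht : p.totalDegree = 0 := by
    rw [totalDegree_eq_zero_iff]
    intro m hm i
    obtain ⟨q, hq, hi, hpq⟩ := h i
    exact Nat.le_zero.mp (degreeOf_eq_zero_of_dvd hq hi hpq ▸ monomial_le_degreeOf i hm)
  rw [totalDegree_eq_zero_iff_eq_C] at ht
  have hc : p.coeff 0 ≠ 0 := fun h => hp.ne_zero (by rw [ht, h, map_zero])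
  exact hp.not_isUnit (ht ▸ (isUnit_iff_ne_zero.mpr hc).map C)

theorem degreeOf_X_pow_add_X_pow {i j k : Fin 3} (hj : i ≠ j) (hk : i ≠ k) (c : ℂ) (d : ℕ) :
    degreeOf i (X j ^ d + C c * X k ^ d : MvPolynomial (Fin 3) ℂ) = 0 := by
  refine Nat.le_zero.mp ((degreeOf_add_le _ _ _).trans (max_le ?_ ?_))
  · rw [degreeOf_X_pow_of_ne d hj]
  · exact (degreeOf_C_mul_le _ _ _).trans (degreeOf_X_pow_of_ne d hk).le

theorem X_pow_add_X_pow_ne_zero {j k : Fin 3} (hjk : j ≠ k) (c : ℂ) {d : ℕ} (hd : d ≠ 0) :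
    (X j ^ d + C c * X k ^ d : MvPolynomial (Fin 3) ℂ) ≠ 0 := by
  intro h
  have := congrArg (eval (Pi.single j 1)) h
  simp [hjk.symm, hd] at this

theorem not_dvd_X_of_dvd_X {p : MvPolynomial (Fin 3) ℂ} {i j : Fin 3} (hp : Prime p)
    (hij : i ≠ j) (hi : p ∣ X i) : ¬ p ∣ X j := by
  intro hj
  have h : X i ∣ p := hp.irreducible.dvd_symm X_prime.irreducible hi
  exact hij (X_dvd_X.mp (h.trans hj))

theorem not_dvd_X_pow_add_X_pow_of_dvd_X {p : MvPolynomial (Fin 3) ℂ} {j k : Fin 3}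
    (hp : Prime p) (hjk : j ≠ k) {c : ℂ} (hc : c ≠ 0) {d : ℕ} (hd : d ≠ 0) (i : Fin 3)
    (hi : p ∣ X i) : ¬ p ∣ X j ^ d + C c * X k ^ d := by
  intro h
  have hu : IsUnit (C c : MvPolynomial (Fin 3) ℂ) := (isUnit_iff_ne_zero.mpr hc).map C
  by_cases hij : i = j
  · subst hij
    have := (dvd_add_right (dvd_pow hi hd)).mp h
    exact not_dvd_X_of_dvd_X hp hjk hi (hp.dvd_of_dvd_pow (hu.dvd_mul_left.mp this))
  by_cases hik : i = k
  · subst hik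
    have := (dvd_add_left ((dvd_pow hi hd).mul_left _)).mp h
    exact not_dvd_X_of_dvd_X hp hij hi (hp.dvd_of_dvd_pow this)
  refine not_prime_of_forall_dvd hp fun l => ?_
  by_cases hl : l = i
  · subst hl
    exact ⟨_, X_pow_add_X_pow_ne_zero hjk c hd, degreeOf_X_pow_add_X_pow hij hik c d, h⟩
  · exact ⟨_, X_ne_zero i, degreeOf_X_of_ne hl, hi⟩

theorem C_two : (C 2 : MvPolynomial (Fin 3) ℂ) = 2 :=
  map_ofNat C 2

theorem pderiv_two (i : Fin 3) : pderiv i (2 : MvPolynomial (Fin 3) ℂ) = 0 := by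
  rw [← C_two, pderiv_C]

theorem pderiv_X_pow_succ_self (i : Fin 3) (n : ℕ) :
    pderiv i (X i ^ (n + 1) : MvPolynomial (Fin 3) ℂ) = ((n + 1 : ℕ) : MvPolynomial (Fin 3) ℂ) * X i ^ n := by
  simp

theorem pderiv_X_pow_of_ne {i j : Fin 3} (h : j ≠ i) (n : ℕ) :
    pderiv i (X j ^ n : MvPolynomial (Fin 3) ℂ) = 0 := by
  simp [pderiv_X_of_ne h]

theorem dvd_X_of_dvd_natCast_mul_X_pow {p : MvPolynomial (Fin 3) ℂ} (hp : Prime p) {i : Fin 3}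
    {k n : ℕ} (hk : k ≠ 0) (h : p ∣ (k : MvPolynomial (Fin 3) ℂ) * X i ^ n) : p ∣ X i :=
  hp.dvd_of_dvd_pow ((isUnit_natCast hk).dvd_mul_left.mp h)

theorem noMultipleComponent_X (i : Fin 3) : NoMultipleComponent (X i) := by
  intro p hp _ h
  have := h i
  rw [pderiv_X_self] at this
  exact hp.not_isUnit (isUnit_of_dvd_one this)

theorem noMultipleComponent_X_pow_add_X_pow {j k : Fin 3} (hjk : j ≠ k) {c : ℂ} (hc : c ≠ 0)
    {d : ℕ} (hd : d ≠ 0) : NoMultipleComponent (X j ^ d + C c * X k ^ d) := by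
  obtain ⟨n, rfl⟩ := Nat.exists_eq_succ_of_ne_zero hd
  intro p hp hQ h
  have hj := h j
  rw [map_add, pderiv_X_pow_succ_self, pderiv_C_mul, pderiv_X_pow_of_ne hjk.symm, mul_zero,
    add_zero] at hj
  exact not_dvd_X_pow_add_X_pow_of_dvd_X hp hjk hc hd j
    (dvd_X_of_dvd_natCast_mul_X_pow hp n.succ_ne_zero hj) hQ

theorem noMultipleComponent_fermat {d : ℕ} (hd : d ≠ 0) :
    NoMultipleComponent (X 0 ^ d + X 1 ^ d + X 2 ^ d) := by
  obtain ⟨n, rfl⟩ := Nat.exists_eq_succ_of_ne_zero hd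
  intro p hp _ h
  have h0 := h 0
  have h1 := h 1
  simp only [Nat.succ_eq_add_one, map_add, pderiv_X_pow_succ_self, pderiv_X_pow_of_ne, ne_eq, Fin.reduceEq,
    not_false_eq_true, add_zero, zero_add] at h0 h1
  exact not_dvd_X_of_dvd_X hp zero_ne_one (dvd_X_of_dvd_natCast_mul_X_pow hp n.succ_ne_zero h0)
    (dvd_X_of_dvd_natCast_mul_X_pow hp n.succ_ne_zero h1)

theorem X_pow_sub_X_pow_eq (d : ℕ) :
    (X 0 ^ d - X 1 ^ d : MvPolynomial (Fin 3) ℂ) = X 0 ^ d + C (-1) * X 1 ^ d := by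
  rw [map_neg, map_one]
  ring

theorem X_pow_add_two_mul_X_pow_eq (i : Fin 3) (d : ℕ) :
    (X 2 ^ d + 2 * X i ^ d : MvPolynomial (Fin 3) ℂ) = X 2 ^ d + C 2 * X i ^ d := by
  rw [map_ofNat]

theorem not_dvd_of_dvd_X_pow_sub_X_pow {d : ℕ} (hd : d ≠ 0) {p : MvPolynomial (Fin 3) ℂ}
    (hp : Prime p) (hA : p ∣ X 0 ^ d - X 1 ^ d) : ¬ p ∣ X 2 ^ d + 2 * X 1 ^ d := by
  intro hB
  have hC : p ∣ X 2 ^ d + 2 * X 0 ^ d := by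
    have h := dvd_add hB (hA.mul_left 2)
    ring_nf at h ⊢
    exact h
  rw [X_pow_sub_X_pow_eq] at hA
  rw [X_pow_add_two_mul_X_pow_eq] at hB hC
  refine not_prime_of_forall_dvd hp ?_
  simp only [Fin.forall_fin_succ]
  exact ⟨⟨_, X_pow_add_X_pow_ne_zero (by decide) 2 hd,
      degreeOf_X_pow_add_X_pow (by decide) (by decide) 2 d, hB⟩,
    ⟨_, X_pow_add_X_pow_ne_zero (by decide) 2 hd,
      degreeOf_X_pow_add_X_pow (by decide) (by decide) 2 d, hC⟩,
    ⟨_, X_pow_add_X_pow_ne_zero (by decide) (-1) hd,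
      degreeOf_X_pow_add_X_pow (by decide) (by decide) (-1) d, hA⟩, fun i => i.elim0⟩

theorem dvd_X_pow_sub_X_pow_of_dvd {d : ℕ} {p : MvPolynomial (Fin 3) ℂ}
    (hB : p ∣ X 2 ^ d + 2 * X 1 ^ d) (hC : p ∣ X 2 ^ d + 2 * X 0 ^ d) :
    p ∣ X 0 ^ d - X 1 ^ d := by
  have h := dvd_sub hC hB
  rw [show (X 2 ^ d + 2 * X 0 ^ d - (X 2 ^ d + 2 * X 1 ^ d) : MvPolynomial (Fin 3) ℂ) =
    ((2 : ℕ) : MvPolynomial (Fin 3) ℂ) * (X 0 ^ d - X 1 ^ d) by push_cast; ring] at h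
  exact (isUnit_natCast two_ne_zero).dvd_mul_left.mp h

theorem noMultipleComponent_pencil {d : ℕ} (hd : d ≠ 0) :
    NoMultipleComponent ((X 0 ^ d - X 1 ^ d) * (X 2 ^ d + 2 * X 1 ^ d) *
      (X 2 ^ d + 2 * X 0 ^ d)) := by
  refine (NoMultipleComponent.mul ?_ ?_ ?_).mul ?_ ?_
  · rw [X_pow_sub_X_pow_eq]
    exact noMultipleComponent_X_pow_add_X_pow (by decide) (by norm_num) hd
  · rw [X_pow_add_two_mul_X_pow_eq]
    exact noMultipleComponent_X_pow_add_X_pow (by decide) (by norm_num) hd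
  · exact fun p hp => not_dvd_of_dvd_X_pow_sub_X_pow hd hp
  · rw [X_pow_add_two_mul_X_pow_eq]
    exact noMultipleComponent_X_pow_add_X_pow (by decide) (by norm_num) hd
  · intro p hp h hC
    rcases hp.dvd_or_dvd h with hA | hB
    · refine not_dvd_of_dvd_X_pow_sub_X_pow hd hp hA ?_
      have h := dvd_sub hC (hA.mul_left 2)
      ring_nf at h ⊢
      exact h
    · exact not_dvd_of_dvd_X_pow_sub_X_pow hd hp (dvd_X_pow_sub_X_pow_of_dvd hB hC) hB

theorem noMultipleComponent_coordinates_mul_pencil {d : ℕ} (hd : d ≠ 0) :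
    NoMultipleComponent (X 0 * X 1 * X 2 *
      ((X 0 ^ d - X 1 ^ d) * (X 2 ^ d + 2 * X 1 ^ d) * (X 2 ^ d + 2 * X 0 ^ d))) := by
  refine NoMultipleComponent.mul (((noMultipleComponent_X 0).mul (noMultipleComponent_X 1)
    ?_).mul (noMultipleComponent_X 2) ?_) (noMultipleComponent_pencil hd) ?_
  · exact fun p hp => not_dvd_X_of_dvd_X hp (by decide)
  · intro p hp h
    exact (hp.dvd_or_dvd h).elim (not_dvd_X_of_dvd_X hp (by decide))
      (not_dvd_X_of_dvd_X hp (by decide))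
  · intro p hp h
    obtain ⟨i, hi⟩ : ∃ i, p ∣ X i := by
      rcases hp.dvd_or_dvd h with h | h
      · rcases hp.dvd_or_dvd h with h | h
        exacts [⟨_, h⟩, ⟨_, h⟩]
      · exact ⟨_, h⟩
    rw [X_pow_sub_X_pow_eq, X_pow_add_two_mul_X_pow_eq, X_pow_add_two_mul_X_pow_eq]
    refine hp.not_dvd_mul (hp.not_dvd_mul ?_ ?_) ?_
    all_goals
      exact not_dvd_X_pow_add_X_pow_of_dvd_X hp (by decide) (by norm_num) hd i hi

theorem noMultipleComponent_fermat_mul_pencil {d : ℕ} (hd : d ≠ 0) :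
    NoMultipleComponent ((X 0 ^ d + X 1 ^ d + X 2 ^ d) *
      ((X 0 ^ d - X 1 ^ d) * (X 2 ^ d + 2 * X 1 ^ d) * (X 2 ^ d + 2 * X 0 ^ d))) := by
  refine (noMultipleComponent_fermat hd).mul (noMultipleComponent_pencil hd) fun p hp hF => ?_
  have hAB (hA : p ∣ X 0 ^ d - X 1 ^ d) : False := by
    refine not_dvd_of_dvd_X_pow_sub_X_pow hd hp hA ?_
    have h := dvd_sub hF hA
    ring_nf at h ⊢
    exact h
  refine hp.not_dvd_mul (hp.not_dvd_mul hAB fun hB => hAB ?_) fun hC => hAB ?_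
  · have h := dvd_sub hF hB
    ring_nf at h ⊢
    exact h
  · have h := dvd_sub hC hF
    ring_nf at h ⊢
    exact h

/-- The linear form with coefficients `a`, `b`, `c` in the powers `x^d`, `y^d`, `z^d`. -/
noncomputable def powerForm (d : ℕ) (a b c : ℤ) : MvPolynomial (Fin 3) ℂ :=
  (a : MvPolynomial (Fin 3) ℂ) * X 0 ^ d + (b : MvPolynomial (Fin 3) ℂ) * X 1 ^ d +
    (c : MvPolynomial (Fin 3) ℂ) * X 2 ^ d

theorem isHomogeneous_powerForm (d : ℕ) (a b c : ℤ) : (powerForm d a b c).IsHomogeneous d := by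
  have h (a : ℤ) (i : Fin 3) :
      ((a : MvPolynomial (Fin 3) ℂ) * X i ^ d).IsHomogeneous d := by
    rw [← map_intCast (C : ℂ →+* MvPolynomial (Fin 3) ℂ)]
    exact isHomogeneous_C_mul_X_pow _ _ _
  exact ((h a 0).add (h b 1)).add (h c 2)

theorem isHomogeneous_X_mul_powerForm (d : ℕ) (a b c : ℤ) (i : Fin 3) :
    (X i * powerForm d a b c).IsHomogeneous (d + 1) :=
  add_comm 1 d ▸ (isHomogeneous_X ℂ i).mul (isHomogeneous_powerForm d a b c)

theorem isHomogeneous_X_mul_quadratic {d : ℕ} {p q r : MvPolynomial (Fin 3) ℂ}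
    (hp : p.IsHomogeneous d) (hq : q.IsHomogeneous d) (hr : r.IsHomogeneous d) (i : Fin 3) :
    (X i * (X 0 ^ d * p + X 1 ^ d * q + X 2 ^ d * r)).IsHomogeneous (2 * d + 1) := by
  rw [show 2 * d + 1 = 1 + (d + d) by ring]
  exact (isHomogeneous_X ℂ i).mul ((((isHomogeneous_X_pow 0 d).mul hp).add
    ((isHomogeneous_X_pow 1 d).mul hq)).add ((isHomogeneous_X_pow 2 d).mul hr))

theorem isHomogeneous_X_pow_mul_X_pow (n : ℕ) (i j : Fin 3) :
    (X i ^ n * X j ^ n : MvPolynomial (Fin 3) ℂ).IsHomogeneous (2 * n) :=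
  two_mul n ▸ (isHomogeneous_X_pow i n).mul (isHomogeneous_X_pow j n)

theorem isHomogeneous_pencil (d : ℕ) :
    ((X 0 ^ d - X 1 ^ d) * (X 2 ^ d + 2 * X 1 ^ d) * (X 2 ^ d + 2 * X 0 ^ d) :
      MvPolynomial (Fin 3) ℂ).IsHomogeneous (3 * d) := by
  have hA := isHomogeneous_powerForm d 1 (-1) 0
  have hB := isHomogeneous_powerForm d 0 2 1
  have hC := isHomogeneous_powerForm d 2 0 1
  convert (hA.mul hB).mul hC using 1
  · simp only [powerForm]
    push_cast
    ring
  · ring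

/-- The syzygy `((yz)^n, (xz)^n, -2(xy)^n)`, which annihilates `x^d - y^d`, `z^d + 2y^d` and
`z^d + 2x^d` when `d = n + 1`. -/
noncomputable def pencilSyzygy (n : ℕ) : Fin 3 → MvPolynomial (Fin 3) ℂ :=
  ![X 1 ^ n * X 2 ^ n, X 0 ^ n * X 2 ^ n, C (-2) * (X 0 ^ n * X 1 ^ n)]

theorem isHomogeneous_pencilSyzygy (n : ℕ) (i : Fin 3) :
    (pencilSyzygy n i).IsHomogeneous (2 * n) := by
  revert i
  simp only [Fin.forall_fin_succ]
  exact ⟨isHomogeneous_X_pow_mul_X_pow n 1 2, isHomogeneous_X_pow_mul_X_pow n 0 2,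
    (isHomogeneous_X_pow_mul_X_pow n 0 1).C_mul _, fun i => i.elim0⟩

theorem isFreeWithExponents_pencil (n : ℕ) :
    IsFreeWithExponents
      ((X 0 ^ (n + 1) - X 1 ^ (n + 1)) * (X 2 ^ (n + 1) + 2 * X 1 ^ (n + 1)) *
        (X 2 ^ (n + 1) + 2 * X 0 ^ (n + 1)) : MvPolynomial (Fin 3) ℂ)
      (n + 1 + 1) (2 * n) := by
  refine isFreeWithExponents_of_cross isUnit_one
    (e₁ := ![X 0 * powerForm (n + 1) (2 * (n + 1)) (-4 * (n + 1)) (2 * (n + 1)),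
      X 1 * powerForm (n + 1) (-4 * (n + 1)) (2 * (n + 1)) (2 * (n + 1)),
      X 2 * powerForm (n + 1) (-4 * (n + 1)) (-4 * (n + 1)) (-(n + 1))])
    (e₂ := pencilSyzygy n)
    ((noMultipleComponent_pencil n.succ_ne_zero).not_forall_dvd_pderiv (by omega)
      (isHomogeneous_pencil _)) ?_ ?_ ?_ ?_ (isHomogeneous_pencilSyzygy n)
  · simp [pencilSyzygy, powerForm, pderiv_two, C_two]
    ring
  · simp [pencilSyzygy, powerForm, pderiv_two, C_two]
    ring
  · simp [pencilSyzygy, powerForm, pderiv_two, C_two]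
    ring
  simp only [Fin.forall_fin_succ]
  exact ⟨isHomogeneous_X_mul_powerForm .., isHomogeneous_X_mul_powerForm ..,
    isHomogeneous_X_mul_powerForm .., fun i => i.elim0⟩

theorem isFreeWithExponents_coordinates_mul_pencil (n : ℕ) :
    IsFreeWithExponents
      (X 0 * X 1 * X 2 *
        ((X 0 ^ (n + 1) - X 1 ^ (n + 1)) * (X 2 ^ (n + 1) + 2 * X 1 ^ (n + 1)) *
          (X 2 ^ (n + 1) + 2 * X 0 ^ (n + 1))) : MvPolynomial (Fin 3) ℂ)
      (n + 1 + 1) (2 * (n + 1) + 1) := by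
  have hunit : IsUnit (-((6 * (n + 2) : ℕ) : MvPolynomial (Fin 3) ℂ)) :=
    (isUnit_natCast (by omega)).neg
  have hom := (((isHomogeneous_X ℂ (0 : Fin 3)).mul (isHomogeneous_X ℂ 1)).mul
    (isHomogeneous_X ℂ 2)).mul (isHomogeneous_pencil (n + 1))
  set d : ℕ := n + 1 with hd
  set s : ℤ := 2 * d + 1 with hs
  set t : ℤ := d + 2 with ht
  refine isFreeWithExponents_of_cross hunit
    (e₁ := ![X 0 * powerForm d (2 * t) (-2 * s) s, X 1 * powerForm d (-2 * s) (2 * t) s,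
      X 2 * powerForm d (-2 * s) (-2 * s) (-t)])
    (e₂ := ![
      X 0 * (X 0 ^ d * powerForm d (4 * t) (-4 * d) (2 * d) +
        X 1 ^ d * powerForm d 0 (-4 * s) (2 * d) + X 2 ^ d * powerForm d 0 0 (-s)),
      X 1 * (X 0 ^ d * powerForm d (-4 * s) (-4 * d) (2 * d) +
        X 1 ^ d * powerForm d 0 (4 * t) (2 * d) + X 2 ^ d * powerForm d 0 0 (-s)),
      X 2 * (X 0 ^ d * powerForm d (-4 * s) (-4 * d) (2 * d) +
        X 1 ^ d * powerForm d 0 (-4 * s) (2 * d) + X 2 ^ d * powerForm d 0 0 t)])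
    ((noMultipleComponent_coordinates_mul_pencil n.succ_ne_zero).not_forall_dvd_pderiv
      (by omega) hom) ?_ ?_ ?_ ?_ ?_
  · simp [powerForm, pderiv_two, hs, ht, hd]
    ring
  · simp [powerForm, pderiv_two, hs, ht, hd]
    ring
  · simp [powerForm, pderiv_two, hs, ht, hd]
    ring
  · simp only [Fin.forall_fin_succ]
    exact ⟨isHomogeneous_X_mul_powerForm .., isHomogeneous_X_mul_powerForm ..,
      isHomogeneous_X_mul_powerForm .., fun i => i.elim0⟩
  · have h := fun a b c => isHomogeneous_powerForm d a b c
    simp only [Fin.forall_fin_succ]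
    exact ⟨isHomogeneous_X_mul_quadratic (h _ _ _) (h _ _ _) (h _ _ _) 0,
      isHomogeneous_X_mul_quadratic (h _ _ _) (h _ _ _) (h _ _ _) 1,
      isHomogeneous_X_mul_quadratic (h _ _ _) (h _ _ _) (h _ _ _) 2, fun i => i.elim0⟩

theorem isFreeWithExponents_fermat_mul_pencil (n : ℕ) :
    IsFreeWithExponents
      ((X 0 ^ (n + 1) + X 1 ^ (n + 1) + X 2 ^ (n + 1)) *
        ((X 0 ^ (n + 1) - X 1 ^ (n + 1)) * (X 2 ^ (n + 1) + 2 * X 1 ^ (n + 1)) *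
          (X 2 ^ (n + 1) + 2 * X 0 ^ (n + 1))) : MvPolynomial (Fin 3) ℂ)
      (2 * n) (2 * (n + 1) + 1) := by
  have hom := (((isHomogeneous_X_pow (R := ℂ) (0 : Fin 3) (n + 1)).add
    (isHomogeneous_X_pow 1 (n + 1))).add (isHomogeneous_X_pow 2 (n + 1))).mul
    (isHomogeneous_pencil (n + 1))
  set d : ℕ := n + 1 with hd
  refine isFreeWithExponents_of_cross isUnit_one.neg (e₁ := pencilSyzygy n)
    (e₂ := ![
      X 0 * (X 0 ^ d * powerForm d (2 * d) 0 (6 * d) +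
        X 1 ^ d * powerForm d 0 (-6 * d) (-6 * d) + X 2 ^ d * powerForm d 0 0 (3 * d)),
      X 1 * (X 0 ^ d * powerForm d (-6 * d) 0 (-6 * d) +
        X 1 ^ d * powerForm d 0 (2 * d) (6 * d) + X 2 ^ d * powerForm d 0 0 (3 * d)),
      X 2 * (X 0 ^ d * powerForm d (-6 * d) 0 (-6 * d) +
        X 1 ^ d * powerForm d 0 (-6 * d) (-6 * d) + X 2 ^ d * powerForm d 0 0 (-d))])
    ((noMultipleComponent_fermat_mul_pencil n.succ_ne_zero).not_forall_dvd_pderiv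
      (by omega) hom) ?_ ?_ ?_ (isHomogeneous_pencilSyzygy n) ?_
  · simp [pencilSyzygy, powerForm, pderiv_two, C_two, hd]
    ring
  · simp [pencilSyzygy, powerForm, pderiv_two, C_two, hd]
    ring
  · simp [pencilSyzygy, powerForm, pderiv_two, C_two, hd]
    ring
  · have h := fun a b c => isHomogeneous_powerForm d a b c
    simp only [Fin.forall_fin_succ]
    exact ⟨isHomogeneous_X_mul_quadratic (h _ _ _) (h _ _ _) (h _ _ _) 0,
      isHomogeneous_X_mul_quadratic (h _ _ _) (h _ _ _) (h _ _ _) 1,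
      isHomogeneous_X_mul_quadratic (h _ _ _) (h _ _ _) (h _ _ _) 2, fun i => i.elim0⟩

/-- For `d ≥ 3`: (i) the line arrangement `B_z ∪ M_x ∪ N_y`, of degree `3d`, is a free
curve with exponents `(d+1, 2d-2)`; (ii) `V(xyz) ∪ B_z ∪ M_x ∪ N_y`, of degree `3d+3`, is
free with exponents `(d+1, 2d+1)`; (iii) `F_d ∪ B_z ∪ M_x ∪ N_y`, of degree `4d`, is free
with exponents `(2d-2, 2d+1)`.  Here `B_z = V(x^d - y^d)`, `M_x = V(z^d + 2y^d)`,
`N_y = V(z^d + 2x^d)` and `F_d = V(x^d + y^d + z^d)`. -/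
theorem fermat_free_line_arrangements (d : ℕ) (hd : 3 ≤ d) :
    IsFreeWithExponents
      ((X 0 ^ d - X 1 ^ d) * (X 2 ^ d + 2 * X 1 ^ d) * (X 2 ^ d + 2 * X 0 ^ d) :
        MvPolynomial (Fin 3) ℂ)
      (d + 1) (2 * d - 2) ∧
    IsFreeWithExponents
      (X 0 * X 1 * X 2 *
        ((X 0 ^ d - X 1 ^ d) * (X 2 ^ d + 2 * X 1 ^ d) * (X 2 ^ d + 2 * X 0 ^ d)) :
        MvPolynomial (Fin 3) ℂ)
      (d + 1) (2 * d + 1) ∧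
    IsFreeWithExponents
      ((X 0 ^ d + X 1 ^ d + X 2 ^ d) *
        ((X 0 ^ d - X 1 ^ d) * (X 2 ^ d + 2 * X 1 ^ d) * (X 2 ^ d + 2 * X 0 ^ d)) :
        MvPolynomial (Fin 3) ℂ)
      (2 * d - 2) (2 * d + 1) := by
  obtain ⟨n, rfl⟩ : ∃ n, d = n + 1 := ⟨d - 1, by omega⟩
  rw [show 2 * (n + 1) - 2 = 2 * n by omega]
  exact ⟨isFreeWithExponents_pencil n, isFreeWithExponents_coordinates_mul_pencil n,
    isFreeWithExponents_fermat_mul_pencil n⟩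
end
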